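/- arXiv:2107.03524 — 6 statements merged into one kernel-verified Lean document; each statement's English description precedes it below -/
import Mathlib

section
/- If v : ℝ^n → ℝ is bounded and uniformly continuous, then the function x ↦ H_sup^c v(x) := sup_{ξ∈U} [ v(x + g_ξ(x,ξ)) − c(x,ξ) ] is uniformly continuous on ℝ^n. -/
open Set

/-- If `a i ≤ b i + ε` for every index `i`, the same bound holds for the suprema. -/
theorem ciSup_le_ciSup_add {ι : Type*} [Nonempty ι] {a b : ι → ℝ} {ε : ℝ}
    (hb : BddAbove (range b)) (h : ∀ i, a i ≤ b i + ε) :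
    ⨆ i, a i ≤ (⨆ i, b i) + ε :=
  ciSup_le fun i => (h i).trans (by gcongr; exact le_ciSup hb i)

/-- A pointwise bounded above, uniformly equicontinuous family of real functions has a uniformly
continuous supremum. -/
theorem UniformEquicontinuous.uniformContinuous_ciSup {ι X : Type*} [Nonempty ι]
    [PseudoMetricSpace X] {f : ι → X → ℝ} (hf : UniformEquicontinuous f)
    (hb : ∀ x, BddAbove (range fun i => f i x)) :
    UniformContinuous fun x => ⨆ i, f i x := by
  rw [Metric.uniformContinuous_iff]
  intro ε hε
  obtain ⟨δ, hδ, h⟩ := Metric.uniformEquicontinuous_iff.1 hf (ε / 2) (half_pos hε)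
  refine ⟨δ, hδ, fun {x y} hxy => ?_⟩
  have key : ∀ i, |f i x - f i y| < ε / 2 := fun i => h x y hxy i
  have h₁ := ciSup_le_ciSup_add (hb y) fun i =>
    (by linarith [(abs_lt.1 (key i)).2] : f i x ≤ f i y + ε / 2)
  have h₂ := ciSup_le_ciSup_add (hb x) fun i =>
    (by linarith [(abs_lt.1 (key i)).1] : f i y ≤ f i x + ε / 2)
  rw [Real.dist_eq, abs_lt]
  constructor <;> linarith

theorem stmt_1
    {n p : ℕ} (hn : 0 < n) (hp : 0 < p)
    (U : Set (EuclideanSpace ℝ (Fin p)))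
    (hUne : U.Nonempty) (hUconv : Convex ℝ U) (hUcone : ∀ r : ℝ, 0 < r → ∀ ξ ∈ U, r • ξ ∈ U)
    (gξ : EuclideanSpace ℝ (Fin n) → EuclideanSpace ℝ (Fin p) → EuclideanSpace ℝ (Fin n))
    (Cgξ : ℝ) (hCgξ : 0 < Cgξ)
    (hgξ : ∀ (ξ : EuclideanSpace ℝ (Fin p)) (x y : EuclideanSpace ℝ (Fin n)),
      ‖gξ x ξ - gξ y ξ‖ ≤ Cgξ * ‖x - y‖)
    (c : EuclideanSpace ℝ (Fin n) → EuclideanSpace ℝ (Fin p) → ℝ)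
    (Cc : ℝ) (hCc : 0 < Cc)
    (hcLip : ∀ ξ ∈ U, ∀ x y : EuclideanSpace ℝ (Fin n), |c x ξ - c y ξ| ≤ Cc * ‖x - y‖)
    (hcPos : ∃ c₀ : ℝ, 0 < c₀ ∧ ∀ x : EuclideanSpace ℝ (Fin n), ∀ ξ ∈ U, c₀ ≤ c x ξ)
    (v : EuclideanSpace ℝ (Fin n) → ℝ)
    (hvb : ∃ M : ℝ, ∀ x, |v x| ≤ M) (hvu : UniformContinuous v) :
    UniformContinuous (fun x : EuclideanSpace ℝ (Fin n) =>
      ⨆ ξ : U, (v (x + gξ x ξ.1) - c x ξ.1)) := by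
  have : Nonempty U := hUne.to_subtype
  obtain ⟨c₀, hc₀, hc⟩ := hcPos
  obtain ⟨M, hM⟩ := hvb
  refine UniformEquicontinuous.uniformContinuous_ciSup
    (f := fun (ξ : U) x => v (x + gξ x ξ.1) - c x ξ.1) ?_ fun x => ⟨M, ?_⟩
  · rw [Metric.uniformEquicontinuous_iff]
    intro ε hε
    obtain ⟨δ, hδ, hv⟩ := Metric.uniformContinuous_iff.1 hvu (ε / 2) (half_pos hε)
    refine ⟨min (δ / (1 + Cgξ)) (ε / 2 / Cc), by positivity, fun x y hxy ξ => ?_⟩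
    rw [dist_eq_norm, lt_min_iff, lt_div_iff₀ (by positivity), lt_div_iff₀ hCc] at hxy
    have hvξ : dist (v (x + gξ x ξ.1)) (v (y + gξ y ξ.1)) < ε / 2 := by
      apply hv
      calc dist (x + gξ x ξ.1) (y + gξ y ξ.1)
          ≤ dist x y + dist (gξ x ξ.1) (gξ y ξ.1) := dist_add_add_le _ _ _ _
        _ ≤ ‖x - y‖ + Cgξ * ‖x - y‖ := by
          rw [dist_eq_norm, dist_eq_norm]
          gcongr
          exact hgξ _ _ _
        _ < δ := by linarith [hxy.1]
    have hcξ := hcLip ξ.1 ξ.2 x y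
    calc dist (v (x + gξ x ξ.1) - c x ξ.1) (v (y + gξ y ξ.1) - c y ξ.1)
        ≤ dist (v (x + gξ x ξ.1)) (v (y + gξ y ξ.1)) + dist (c x ξ.1) (c y ξ.1) :=
          dist_sub_sub_le _ _ _ _
      _ < ε := by
        rw [Real.dist_eq (c x ξ.1)]
        linarith [hxy.2]
  · rintro _ ⟨ξ, rfl⟩
    linarith [hc x ξ.1 ξ.2, (abs_le.1 (hM (x + gξ x ξ.1))).2]
end

section
/- Let φ ∈ C¹(ℝ^n), x ∈ ℝ^n and γ > 0 be such that λφ(x) + H⁻(x, Dφ(x)) = γ. Then there exist a Borel measurable map ψ : A → B and t₀ > 0 such that for every measurable θ₁ : [0,t₀] → A, every absolutely continuous y : [0,t₀] → ℝ^n with y(0) = x and ẏ(s) = b(y(s); θ₁(s), ψ(θ₁(s))) for almost every s ∈ [0,t₀], and every t ∈ (0,t₀]: ∫₀ᵗ [ −λφ(y(s)) + Dφ(y(s))·b(y(s); θ₁(s), ψ(θ₁(s))) + f(y(s); θ₁(s), ψ(θ₁(s))) ] e^{−λs} ds ≤ −γt/4. -/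
open Set MeasureTheory

/-- If every point `a` admits some `β` with `(a, β)` in an open relation, then a Borel map selects
such a `β`. -/
theorem exists_measurable_selection_of_isOpen {α β : Type*} [TopologicalSpace α]
    [MeasurableSpace α] [OpensMeasurableSpace α] [TopologicalSpace β]
    [TopologicalSpace.SeparableSpace β] [Nonempty β] [MeasurableSpace β]
    {U : Set (α × β)} (hU : IsOpen U) (h : ∀ a, ∃ b, (a, b) ∈ U) :
    ∃ ψ : α → β, Measurable ψ ∧ ∀ a, (a, ψ a) ∈ U := by
  classical
  have hex : ∀ a, ∃ k : ℕ, (a, TopologicalSpace.denseSeq β k) ∈ U := fun a ↦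
    (TopologicalSpace.denseRange_denseSeq β).exists_mem_open
      (hU.preimage (Continuous.prodMk_right a)) (h a)
  refine ⟨fun a ↦ TopologicalSpace.denseSeq β (Nat.find (hex a)),
    (measurable_from_nat (f := TopologicalSpace.denseSeq β)).comp
      (measurable_find hex fun k ↦ ?_), fun a ↦ Nat.find_spec (hex a)⟩
  exact (hU.preimage (Continuous.prodMk_left (TopologicalSpace.denseSeq β k))).measurableSet

/-- A function equal on `[0, T]` to the primitive of a bounded function `g` agrees there with a
measurable function. Integrability of `g` is not assumed, so the integral may take its default
value. -/
theorem exists_measurable_eqOn_of_eq_integral {E : Type*} [NormedAddCommGroup E] [NormedSpace ℝ E]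
    [MeasurableSpace E] [BorelSpace E] {g y : ℝ → E} {x : E} {M T : ℝ}
    (hg : ∀ s, ‖g s‖ ≤ M) (hy : ∀ t ∈ Icc (0 : ℝ) T, y t = x + ∫ s in (0 : ℝ)..t, g s) :
    ∃ z : ℝ → E, Measurable z ∧ EqOn y z (Icc 0 T) := by
  classical
  set S : Set ℝ := {t ∈ Icc (0 : ℝ) T | IntervalIntegrable g volume 0 t}
  have hSord : S.OrdConnected := by
    refine ⟨fun s hs t ht r hr ↦ ?_⟩
    have hr0 : 0 ≤ r := hs.1.1.trans hr.1
    refine ⟨⟨hr0, hr.2.trans ht.1.2⟩, ht.2.mono_set ?_⟩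
    rw [uIcc_of_le hr0, uIcc_of_le ht.1.1]
    exact Icc_subset_Icc_right hr.2
  have hLip : LipschitzOnWith M.toNNReal y S := by
    refine LipschitzOnWith.of_dist_le_mul fun s hs t ht ↦ ?_
    rw [hy s hs.1, hy t ht.1, dist_add_left, dist_eq_norm,
      intervalIntegral.integral_interval_sub_left hs.2 ht.2,
      Real.coe_toNNReal _ ((norm_nonneg _).trans (hg 0)), Real.dist_eq]
    exact intervalIntegral.norm_integral_le_of_norm_le_const fun r _ ↦ hg r
  refine ⟨S.piecewise y fun _ ↦ x,
    hLip.continuousOn.measurable_piecewise continuousOn_const hSord.measurableSet, fun t ht ↦ ?_⟩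
  by_cases h : t ∈ S
  · simp [h]
  · have hni : ¬ IntervalIntegrable g volume 0 t := fun hi ↦ h ⟨ht, hi⟩
    simp [h, hy t ht, intervalIntegral.integral_undef hni]

/-- A jointly continuous real function varies uniformly little over a compact parameter space. -/
theorem exists_forall_dist_lt_of_compactSpace {E K : Type*} [PseudoMetricSpace E]
    [TopologicalSpace K] [CompactSpace K] {G : E × K → ℝ} (hG : Continuous G) (x : E)
    {ε : ℝ} (hε : 0 < ε) :
    ∃ δ > 0, ∀ z, dist z x < δ → ∀ k, |G (z, k) - G (x, k)| < ε := by
  have hev : ∀ᶠ z in nhds x, ∀ k ∈ (univ : Set K), |G (z, k) - G (x, k)| < ε := by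
    refine isCompact_univ.eventually_forall_of_forall_eventually fun k _ ↦ ?_
    have hc : Continuous fun p : E × K ↦ |G (p.1, p.2) - G (x, p.2)| := by fun_prop
    exact hc.continuousAt.eventually_lt continuousAt_const (by simpa using hε)
  obtain ⟨δ, hδ, h⟩ := Metric.eventually_nhds_iff.1 hev
  exact ⟨δ, hδ, fun z hz k ↦ h hz k (mem_univ k)⟩

theorem stmt_4
    {n l : ℕ} (hn : 0 < n) (hl : 0 < l)
    (lam : ℝ) (hlam : 0 < lam)
    (A B : Set (EuclideanSpace ℝ (Fin l)))
    (hA : IsCompact A) (hB : IsCompact B) (hAne : A.Nonempty) (hBne : B.Nonempty)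
    (b : EuclideanSpace ℝ (Fin n) → A → B → EuclideanSpace ℝ (Fin n))
    (Cb : ℝ) (hCb : 0 < Cb)
    (hbBdd : ∃ M : ℝ, ∀ (x : EuclideanSpace ℝ (Fin n)) (a : A) (β : B), ‖b x a β‖ ≤ M)
    (hbCont : Continuous fun z : EuclideanSpace ℝ (Fin n) × A × B => b z.1 z.2.1 z.2.2)
    (hbLip : ∀ (a : A) (β : B) (x y : EuclideanSpace ℝ (Fin n)),
      ‖b x a β - b y a β‖ ≤ Cb * ‖x - y‖)
    (f : EuclideanSpace ℝ (Fin n) → A → B → ℝ)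
    (Cf : ℝ) (hCf : 0 < Cf)
    (hfBdd : ∃ M : ℝ, ∀ (x : EuclideanSpace ℝ (Fin n)) (a : A) (β : B), |f x a β| ≤ M)
    (hfCont : Continuous fun z : EuclideanSpace ℝ (Fin n) × A × B => f z.1 z.2.1 z.2.2)
    (hfLip : ∀ (a : A) (β : B) (x y : EuclideanSpace ℝ (Fin n)),
      |f x a β - f y a β| ≤ Cf * ‖x - y‖)
    (φ : EuclideanSpace ℝ (Fin n) → ℝ) (hφ : ContDiff ℝ 1 φ)
    (x : EuclideanSpace ℝ (Fin n)) (γ : ℝ) (hγ : 0 < γ)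
    (hH : lam * φ x +
      (⨅ a : A, ⨆ β : B, (-(fderiv ℝ φ x (b x a β)) - f x a β)) = γ) :
    ∃ (ψ : A → B) (t₀ : ℝ), Measurable ψ ∧ 0 < t₀ ∧
      ∀ θ₁ : ℝ → A, Measurable θ₁ →
      ∀ y : ℝ → EuclideanSpace ℝ (Fin n),
        (∀ t ∈ Set.Icc (0:ℝ) t₀,
          y t = x + ∫ s in (0:ℝ)..t, b (y s) (θ₁ s) (ψ (θ₁ s))) →
        ∀ t ∈ Set.Ioc (0:ℝ) t₀,
          (∫ s in (0:ℝ)..t,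
            (-(lam * φ (y s)) + fderiv ℝ φ (y s) (b (y s) (θ₁ s) (ψ (θ₁ s)))
              + f (y s) (θ₁ s) (ψ (θ₁ s))) * Real.exp (-(lam * s)))
            ≤ -(γ * t) / 4 := by
  have : CompactSpace A := isCompact_iff_compactSpace.1 hA
  have : CompactSpace B := isCompact_iff_compactSpace.1 hB
  have : Nonempty A := hAne.to_subtype
  have : Nonempty B := hBne.to_subtype
  set G : EuclideanSpace ℝ (Fin n) × (A × B) → ℝ := fun p ↦
    -(lam * φ p.1) + fderiv ℝ φ p.1 (b p.1 p.2.1 p.2.2) + f p.1 p.2.1 p.2.2 with hGdef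
  have hG : Continuous G := by
    have h1 := hφ.continuous
    have h2 := hφ.continuous_fderiv one_ne_zero
    exact ((continuous_const.mul (h1.comp continuous_fst)).neg.add
      ((h2.comp continuous_fst).clm_apply hbCont)).add hfCont
  obtain ⟨C, hC⟩ : ∃ C, ∀ k, |G (x, k)| ≤ C := by
    obtain ⟨C, hC⟩ := (isCompact_range
      (hG.comp (Continuous.prodMk_right x))).isBounded.exists_norm_le
    exact ⟨C, fun k ↦ hC _ (mem_range_self k)⟩
  obtain ⟨M, hM⟩ := hbBdd
  have hM0 : 0 ≤ M :=
    (norm_nonneg _).trans (hM x (Classical.arbitrary A) (Classical.arbitrary B))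
  have hval : ∀ a β, -(fderiv ℝ φ x (b x a β)) - f x a β = -G (x, (a, β)) - lam * φ x := by
    intro a β
    simp only [hGdef]
    ring
  have hsel : ∀ a : A, ∃ β : B, (a, β) ∈ {k : A × B | G (x, k) < -(3 * γ / 4)} := by
    intro a
    have hbelow : BddBelow (range fun a : A ↦
        ⨆ β : B, (-(fderiv ℝ φ x (b x a β)) - f x a β)) := by
      refine ⟨-C - lam * φ x, ?_⟩
      rintro _ ⟨a, rfl⟩
      refine le_ciSup_of_le ⟨C - lam * φ x, ?_⟩ (Classical.arbitrary B) ?_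
      · rintro _ ⟨β, rfl⟩
        simp only [hval]
        linarith [(abs_le.1 (hC (a, β))).1]
      · rw [hval]
        linarith [(abs_le.1 (hC (a, Classical.arbitrary B))).2]
    have hle := ciInf_le hbelow a
    obtain ⟨β, hβ⟩ := exists_lt_of_lt_ciSup
      (show γ - lam * φ x - γ / 4 < ⨆ β : B, (-(fderiv ℝ φ x (b x a β)) - f x a β) by linarith)
    refine ⟨β, ?_⟩
    rw [hval] at hβ
    simp only [mem_ofPred_eq]
    linarith
  obtain ⟨ψ, hψ, hψG⟩ := exists_measurable_selection_of_isOpen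
    (isOpen_lt (hG.comp (Continuous.prodMk_right x)) continuous_const) hsel
  obtain ⟨δ, hδ, hδG⟩ := exists_forall_dist_lt_of_compactSpace hG x (by positivity : 0 < γ / 4)
  refine ⟨ψ, min (δ / (2 * (M + 1))) (1 / (2 * lam)), hψ, by positivity, ?_⟩
  set t₀ := min (δ / (2 * (M + 1))) (1 / (2 * lam))
  have hMt₀ : M * t₀ < δ := by
    have h : t₀ * (2 * (M + 1)) ≤ δ := (le_div_iff₀ (by positivity)).1 (min_le_left _ _)
    have : 0 < t₀ := by positivity
    nlinarith
  have hlamt₀ : lam * t₀ ≤ 1 / 2 := by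
    have h : t₀ * (2 * lam) ≤ 1 := (le_div_iff₀ (by positivity)).1 (min_le_right _ _)
    linarith
  intro θ₁ hθ₁ y hy t ht
  obtain ⟨z, hz, hyz⟩ := exists_measurable_eqOn_of_eq_integral
    (g := fun s ↦ b (y s) (θ₁ s) (ψ (θ₁ s))) (fun s ↦ hM _ _ _) hy
  set F : ℝ → ℝ := fun s ↦ G (y s, (θ₁ s, ψ (θ₁ s))) * Real.exp (-(lam * s)) with hF
  have hsub : ∀ s ∈ Icc 0 t, s ∈ Icc 0 t₀ := fun s hs ↦ ⟨hs.1, hs.2.trans ht.2⟩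
  have hyx : ∀ s ∈ Icc 0 t, dist (y s) x < δ := by
    intro s hs
    rw [hy s (hsub s hs), dist_eq_norm, add_sub_cancel_left]
    have hn := intervalIntegral.norm_integral_le_of_norm_le_const (a := 0) (b := s)
      (f := fun s ↦ b (y s) (θ₁ s) (ψ (θ₁ s))) (C := M) fun r _ ↦ hM _ _ _
    rw [sub_zero, abs_of_nonneg hs.1] at hn
    exact (hn.trans (mul_le_mul_of_nonneg_left (hsub s hs).2 hM0)).trans_lt hMt₀
  have hFmeas : AEStronglyMeasurable F (volume.restrict (Icc 0 t)) := by
    have hm : Measurable fun s ↦ G (z s, (θ₁ s, ψ (θ₁ s))) * Real.exp (-(lam * s)) :=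
      (hG.measurable.comp (hz.prodMk (hθ₁.prodMk (hψ.comp hθ₁)))).mul (by fun_prop)
    refine hm.aestronglyMeasurable.congr ?_
    filter_upwards [ae_restrict_mem measurableSet_Icc] with s hs
    simp only [hF, hyz (hsub s hs)]
  have hexp : ∀ s ∈ Icc 0 t, 1 / 2 ≤ Real.exp (-(lam * s)) ∧ Real.exp (-(lam * s)) ≤ 1 := by
    intro s hs
    have h1 : lam * s ≤ lam * t₀ := mul_le_mul_of_nonneg_left (hsub s hs).2 hlam.le
    exact ⟨by linarith [Real.add_one_le_exp (-(lam * s))],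
      Real.exp_le_one_iff.2 (neg_nonpos.2 (mul_nonneg hlam.le hs.1))⟩
  have hFint : IntervalIntegrable F volume 0 t := by
    rw [intervalIntegrable_iff_integrableOn_Icc_of_le ht.1.le]
    refine IntegrableOn.of_bound (by simp) hFmeas (C + γ / 4) ?_
    filter_upwards [ae_restrict_mem measurableSet_Icc] with s hs
    have hb : |G (y s, (θ₁ s, ψ (θ₁ s)))| ≤ C + γ / 4 := by
      have h1 := hδG _ (hyx s hs) (θ₁ s, ψ (θ₁ s))
      have h2 := hC (θ₁ s, ψ (θ₁ s))
      linarith [abs_sub_abs_le_abs_sub (G (y s, (θ₁ s, ψ (θ₁ s)))) (G (x, (θ₁ s, ψ (θ₁ s))))]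
    rw [hF, Real.norm_eq_abs, abs_mul, Real.abs_exp]
    exact (mul_le_of_le_one_right (abs_nonneg _) (hexp s hs).2).trans hb
  have hFle : ∀ s ∈ Icc 0 t, F s ≤ -(γ / 4) := by
    intro s hs
    have h1 := (abs_lt.1 (hδG _ (hyx s hs) (θ₁ s, ψ (θ₁ s)))).2
    have h2 : G (x, (θ₁ s, ψ (θ₁ s))) < -(3 * γ / 4) := hψG (θ₁ s)
    have h3 := (hexp s hs).1
    simp only [hF]
    nlinarith
  calc ∫ s in (0 : ℝ)..t, F s ≤ ∫ _ in (0 : ℝ)..t, -(γ / 4) :=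
        intervalIntegral.integral_mono_on ht.1.le hFint intervalIntegrable_const hFle
    _ = -(γ * t) / 4 := by
        rw [intervalIntegral.integral_const, smul_eq_mul]
        ring
end

section
/- Let φ ∈ C¹(ℝ^n), x ∈ ℝ^n and γ > 0 be such that λφ(x) + H⁺(x, Dφ(x)) = γ. Then there exist θ̄₂ ∈ B and t₀ > 0 such that for every measurable θ₁ : [0,t₀] → A, every absolutely continuous y : [0,t₀] → ℝ^n with y(0) = x and ẏ(s) = b(y(s); θ₁(s), θ̄₂) for almost every s ∈ [0,t₀], and every t ∈ (0,t₀]: ∫₀ᵗ [ −λφ(y(s)) + Dφ(y(s))·b(y(s); θ₁(s), θ̄₂) + f(y(s); θ₁(s), θ̄₂) ] e^{−λs} ds ≤ −γt/4. -/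
open Set MeasureTheory

/-- A function which on `[0, T]` is an indefinite integral of a bounded function `g` agrees there
with a measurable function. No integrability of `g` is required: where the integral takes its
default value the function is constant. -/
theorem exists_measurable_eqOn_of_eq_add_integral
    {E : Type*} [NormedAddCommGroup E] [NormedSpace ℝ E]
    [MeasurableSpace E] [BorelSpace E]
    {g y : ℝ → E} {x : E} {M T : ℝ} (hg : ∀ s, ‖g s‖ ≤ M)
    (hy : ∀ t ∈ Icc (0 : ℝ) T, y t = x + ∫ s in (0 : ℝ)..t, g s) :
    ∃ y' : ℝ → E, Measurable y' ∧ EqOn y y' (Icc 0 T) := by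
  classical
  set S : Set ℝ := {t ∈ Icc (0 : ℝ) T | IntervalIntegrable g volume 0 t} with hS
  have hord : S.OrdConnected := by
    refine ⟨fun p hp q hq r hr => ⟨⟨hp.1.1.trans hr.1, hr.2.trans hq.1.2⟩, ?_⟩⟩
    refine hq.2.mono_set ?_
    rw [uIcc_of_le (hp.1.1.trans hr.1), uIcc_of_le hq.1.1]
    exact Icc_subset_Icc_right hr.2
  have hlip : LipschitzOnWith M.toNNReal y S := by
    refine LipschitzOnWith.of_dist_le_mul fun p hp q hq => ?_
    rw [hy p hp.1, hy q hq.1, dist_add_left, dist_eq_norm,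
      intervalIntegral.integral_interval_sub_left hp.2 hq.2, Real.dist_eq,
      Real.coe_toNNReal M ((norm_nonneg _).trans (hg 0))]
    exact intervalIntegral.norm_integral_le_of_norm_le_const fun s _ => hg s
  refine ⟨S.piecewise y fun _ => x,
    hlip.continuousOn.measurable_piecewise continuousOn_const hord.measurableSet,
    fun t ht => ?_⟩
  by_cases h : t ∈ S
  · rw [piecewise_eq_of_mem _ _ _ h]
  · rw [piecewise_eq_of_notMem _ _ _ h, hy t ht,
      intervalIntegral.integral_undef fun hi => h ⟨ht, hi⟩, add_zero]

theorem stmt_5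
    {n l : ℕ} (hn : 0 < n) (hl : 0 < l)
    (lam : ℝ) (hlam : 0 < lam)
    (A B : Set (EuclideanSpace ℝ (Fin l)))
    (hA : IsCompact A) (hB : IsCompact B) (hAne : A.Nonempty) (hBne : B.Nonempty)
    (b : EuclideanSpace ℝ (Fin n) → A → B → EuclideanSpace ℝ (Fin n))
    (Cb : ℝ) (hCb : 0 < Cb)
    (hbBdd : ∃ M : ℝ, ∀ (x : EuclideanSpace ℝ (Fin n)) (a : A) (β : B), ‖b x a β‖ ≤ M)
    (hbCont : Continuous fun z : EuclideanSpace ℝ (Fin n) × A × B => b z.1 z.2.1 z.2.2)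
    (hbLip : ∀ (a : A) (β : B) (x y : EuclideanSpace ℝ (Fin n)),
      ‖b x a β - b y a β‖ ≤ Cb * ‖x - y‖)
    (f : EuclideanSpace ℝ (Fin n) → A → B → ℝ)
    (Cf : ℝ) (hCf : 0 < Cf)
    (hfBdd : ∃ M : ℝ, ∀ (x : EuclideanSpace ℝ (Fin n)) (a : A) (β : B), |f x a β| ≤ M)
    (hfCont : Continuous fun z : EuclideanSpace ℝ (Fin n) × A × B => f z.1 z.2.1 z.2.2)
    (hfLip : ∀ (a : A) (β : B) (x y : EuclideanSpace ℝ (Fin n)),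
      |f x a β - f y a β| ≤ Cf * ‖x - y‖)
    (φ : EuclideanSpace ℝ (Fin n) → ℝ) (hφ : ContDiff ℝ 1 φ)
    (x : EuclideanSpace ℝ (Fin n)) (γ : ℝ) (hγ : 0 < γ)
    (hH : lam * φ x +
      (⨆ β : B, ⨅ a : A, (-(fderiv ℝ φ x (b x a β)) - f x a β)) = γ) :
    ∃ (θ₂ : B) (t₀ : ℝ), 0 < t₀ ∧
      ∀ θ₁ : ℝ → A, Measurable θ₁ →
      ∀ y : ℝ → EuclideanSpace ℝ (Fin n),
        (∀ t ∈ Set.Icc (0:ℝ) t₀,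
          y t = x + ∫ s in (0:ℝ)..t, b (y s) (θ₁ s) (θ₂)) →
        ∀ t ∈ Set.Ioc (0:ℝ) t₀,
          (∫ s in (0:ℝ)..t,
            (-(lam * φ (y s)) + fderiv ℝ φ (y s) (b (y s) (θ₁ s) (θ₂))
              + f (y s) (θ₁ s) (θ₂)) * Real.exp (-(lam * s)))
            ≤ -(γ * t) / 4 := by
  obtain ⟨M, hM⟩ := hbBdd
  obtain ⟨N, hN⟩ := hfBdd
  have : Nonempty B := hBne.to_subtype
  have hM0 : 0 ≤ M :=
    (norm_nonneg _).trans (hM x ⟨_, hAne.some_mem⟩ ⟨_, hBne.some_mem⟩)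
  have hDb : ∀ a β, |fderiv ℝ φ x (b x a β)| ≤ ‖fderiv ℝ φ x‖ * M := fun a β =>
    (fderiv ℝ φ x).le_opNorm_of_le (hM x a β)
  obtain ⟨β, hβ⟩ : ∃ β : B, γ - lam * φ x - γ / 4 <
      ⨅ a : A, (-(fderiv ℝ φ x (b x a β)) - f x a β) :=
    exists_lt_of_lt_ciSup (by linarith)
  have hbdd : BddBelow (range fun a : A => -(fderiv ℝ φ x (b x a β)) - f x a β) := by
    refine ⟨-(‖fderiv ℝ φ x‖ * M) - N, ?_⟩
    rintro _ ⟨a, rfl⟩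
    have h₁ := (abs_le.1 (hDb a β)).2
    have h₂ := (abs_le.1 (hN x a β)).2
    simp only
    linarith
  set G : EuclideanSpace ℝ (Fin n) → A → ℝ := fun z a =>
    -(lam * φ z) + fderiv ℝ φ z (b z a β) + f z a β with hG
  have hGx : ∀ a, G x a ≤ -(3 * γ / 4) := fun a => by
    have := hβ.trans_le (ciInf_le hbdd a)
    simp only [hG]
    linarith
  have hφ' : Continuous (fderiv ℝ φ) := hφ.continuous_fderiv one_ne_zero
  have hφc : Continuous φ := hφ.continuous
  set e : EuclideanSpace ℝ (Fin n) → ℝ := fun z =>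
    lam * |φ z - φ x| + ‖fderiv ℝ φ z - fderiv ℝ φ x‖ * M
      + ‖fderiv ℝ φ x‖ * (Cb * ‖z - x‖) + Cf * ‖z - x‖ with he
  have hec : Continuous e := by fun_prop
  have hGe : ∀ z a, |G z a - G x a| ≤ e z := fun z a => by
    have key : G z a - G x a = -(lam * (φ z - φ x))
        + (fderiv ℝ φ z - fderiv ℝ φ x) (b z a β)
        + fderiv ℝ φ x (b z a β - b x a β) + (f z a β - f x a β) := by
      simp only [hG, map_sub, sub_apply]
      ring
    have h₁ : |-(lam * (φ z - φ x))| = lam * |φ z - φ x| := by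
      rw [abs_neg, abs_mul, abs_of_pos hlam]
    have h₂ : |(fderiv ℝ φ z - fderiv ℝ φ x) (b z a β)| ≤ ‖fderiv ℝ φ z - fderiv ℝ φ x‖ * M :=
      (fderiv ℝ φ z - fderiv ℝ φ x).le_opNorm_of_le (hM z a β)
    have h₃ : |fderiv ℝ φ x (b z a β - b x a β)| ≤ ‖fderiv ℝ φ x‖ * (Cb * ‖z - x‖) :=
      (fderiv ℝ φ x).le_opNorm_of_le (hbLip a β z x)
    rw [key]
    refine (abs_add_le _ _).trans (add_le_add ((abs_add_le _ _).trans
      (add_le_add ((abs_add_le _ _).trans (add_le_add h₁.le h₂)) h₃)) (hfLip a β z x))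
  obtain ⟨δ, hδ, hball⟩ : ∃ δ > 0, ∀ z, dist z x < δ → e z < γ / 4 := by
    have hev : ∀ᶠ z in nhds x, e z < γ / 4 :=
      hec.continuousAt.eventually_lt continuousAt_const (by simp [he]; linarith)
    exact Metric.eventually_nhds_iff.1 hev
  refine ⟨β, min (δ / (M + 1)) (1 / (2 * lam)), by positivity, ?_⟩
  set T := min (δ / (M + 1)) (1 / (2 * lam)) with hT
  intro θ₁ hθ₁ y hy t ht
  have hye : ∀ s ∈ Icc (0 : ℝ) T, e (y s) < γ / 4 := fun s hs => by
    refine hball _ ?_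
    have h₁ : ‖∫ r in (0 : ℝ)..s, b (y r) (θ₁ r) β‖ ≤ M * |s - 0| :=
      intervalIntegral.norm_integral_le_of_norm_le_const fun r _ => hM _ _ _
    rw [sub_zero, abs_of_nonneg hs.1] at h₁
    rw [hy s hs, dist_eq_norm, add_sub_cancel_left]
    have h₂ : s * (M + 1) ≤ δ :=
      (le_div_iff₀ (by positivity)).1 (hs.2.trans (min_le_left _ _))
    rcases hs.1.eq_or_lt with rfl | h
    · simpa using hδ
    · linarith
  have hexp : ∀ s ∈ Icc (0 : ℝ) T, 1 / 2 ≤ Real.exp (-(lam * s)) := fun s hs => by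
    have h₁ : s * (2 * lam) ≤ 1 :=
      (le_div_iff₀ (by positivity)).1 (hs.2.trans (min_le_right _ _))
    have h₂ := Real.add_one_le_exp (-(lam * s))
    linarith
  have hsub : Icc 0 t ⊆ Icc 0 T := Icc_subset_Icc_right ht.2
  have hpt : ∀ s ∈ Icc (0 : ℝ) t, G (y s) (θ₁ s) * Real.exp (-(lam * s)) ≤ -γ / 4 := by
    intro s hs
    have h₁ := (abs_le.1 (hGe (y s) (θ₁ s))).2
    have h₂ := hye s (hsub hs)
    have h₃ := hexp s (hsub hs)
    have h₄ := hGx (θ₁ s)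
    nlinarith
  have hint : IntervalIntegrable (fun s => G (y s) (θ₁ s) * Real.exp (-(lam * s))) volume 0 t := by
    obtain ⟨y', hy'm, hyy'⟩ := exists_measurable_eqOn_of_eq_add_integral
      (fun s => hM (y s) (θ₁ s) β) hy
    have hGc : Continuous fun p : EuclideanSpace ℝ (Fin n) × A => G p.1 p.2 := by
      have hb : Continuous fun p : EuclideanSpace ℝ (Fin n) × A => b p.1 p.2 β :=
        hbCont.comp (by fun_prop : Continuous fun p : EuclideanSpace ℝ (Fin n) × A =>
          (p.1, p.2, β))
      have hf : Continuous fun p : EuclideanSpace ℝ (Fin n) × A => f p.1 p.2 β :=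
        hfCont.comp (by fun_prop : Continuous fun p : EuclideanSpace ℝ (Fin n) × A =>
          (p.1, p.2, β))
      have hD : Continuous fun p : EuclideanSpace ℝ (Fin n) × A => fderiv ℝ φ p.1 (b p.1 p.2 β) :=
        (hφ'.comp continuous_fst).clm_apply hb
      exact ((by fun_prop : Continuous fun p : EuclideanSpace ℝ (Fin n) × A =>
        -(lam * φ p.1)).add hD).add hf
    have hmeas : Measurable fun s => G (y' s) (θ₁ s) * Real.exp (-(lam * s)) :=
      (hGc.measurable.comp (hy'm.prodMk hθ₁)).mul (by fun_prop)
    rw [intervalIntegrable_iff_integrableOn_Ioc_of_le ht.1.le]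
    refine Integrable.of_bound (C := |lam * φ x| + ‖fderiv ℝ φ x‖ * M + N + γ / 4) ?_ ?_
    · refine hmeas.aestronglyMeasurable.congr ?_
      filter_upwards [ae_restrict_mem measurableSet_Ioc] with s hs
      rw [hyy' (hsub (Ioc_subset_Icc_self hs))]
    · filter_upwards [ae_restrict_mem measurableSet_Ioc] with s hs
      have h₁ : |G (y s) (θ₁ s)| ≤ |lam * φ x| + ‖fderiv ℝ φ x‖ * M + N + γ / 4 := by
        have hx : |G x (θ₁ s)| ≤ |lam * φ x| + ‖fderiv ℝ φ x‖ * M + N :=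
          (abs_add_le _ _).trans (add_le_add ((abs_add_le _ _).trans
            (add_le_add (abs_neg _).le (hDb _ _))) (hN _ _ _))
        have h₂ := hGe (y s) (θ₁ s)
        have h₃ := hye s (hsub (Ioc_subset_Icc_self hs))
        have h₄ := abs_sub_abs_le_abs_sub (G (y s) (θ₁ s)) (G x (θ₁ s))
        linarith
      have h₂ : Real.exp (-(lam * s)) ≤ 1 :=
        Real.exp_le_one_iff.2 (neg_nonpos.2 (mul_nonneg hlam.le hs.1.le))
      rw [norm_mul, Real.norm_eq_abs, Real.norm_of_nonneg (Real.exp_pos _).le]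
      exact (mul_le_of_le_one_right (abs_nonneg _) h₂).trans h₁
  calc _ ≤ ∫ _ in (0 : ℝ)..t, -γ / 4 :=
        intervalIntegral.integral_mono_on ht.1.le hint intervalIntegrable_const hpt
    _ = -(γ * t) / 4 := by
        rw [intervalIntegral.integral_const, smul_eq_mul]
        ring
end

section
/- If a continuous function v : ℝ^n → ℝ is a viscosity solution of the lower HJBI QVI (L), then for any 0 < μ < 1 the function μv is a viscosity solution of the scaled QVI min{ max[ λw(x) + H⁻_μ(x, Dw(x)), w(x) − H_inf^{χ,μ} w(x) ], w(x) − H_sup^{c,μ} w(x) } = 0, where H_inf^{χ,μ} w(x) := inf_{η∈V}[w(x+g_η(x,η)) + μχ(x,η)], H_sup^{c,μ} w(x) := sup_{ξ∈U}[w(x+g_ξ(x,ξ)) − μc(x,ξ)], and H⁻_μ(x,p) := inf_{θ₁∈A} sup_{θ₂∈B}(−p·b(x;θ₁,θ₂) − μf(x;θ₁,θ₂)). -/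
open Set MeasureTheory

theorem mul_qvi_expression {α β ι κ : Type*} {μ : ℝ} (hμ : 0 ≤ μ) (r w : ℝ)
    (h : α → β → ℝ) (s : ι → ℝ) (t : κ → ℝ) :
    μ * min (max (r + ⨅ a, ⨆ b, h a b) (w - ⨅ i, s i)) (w - ⨆ k, t k) =
      min (max (μ * r + ⨅ a, ⨆ b, μ * h a b) (μ * w - ⨅ i, μ * s i)) (μ * w - ⨆ k, μ * t k) := by
  rw [mul_min_of_nonneg _ _ hμ, mul_max_of_nonneg _ _ hμ]
  simp only [mul_add, mul_sub, Real.mul_iInf_of_nonneg hμ, Real.mul_iSup_of_nonneg hμ]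

theorem scaled_qvi_expression {E α β ι κ : Type*} [NormedAddCommGroup E] [NormedSpace ℝ E]
    {μ : ℝ} (hμ : 0 < μ) (lam w : ℝ) (φ : E → ℝ) (x : E) (b : α → β → E) (f : α → β → ℝ)
    (s s' : ι → ℝ) (t t' : κ → ℝ) :
    min (max (lam * μ * w + ⨅ a, ⨆ b', (-(fderiv ℝ φ x (b a b')) - μ * f a b'))
        (μ * w - ⨅ i, (μ * s i + μ * s' i))) (μ * w - ⨆ k, (μ * t k - μ * t' k)) =
      μ * min (max (lam * w + ⨅ a, ⨆ b', (-(fderiv ℝ (μ⁻¹ • φ) x (b a b')) - f a b'))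
        (w - ⨅ i, (s i + s' i))) (w - ⨆ k, (t k - t' k)) := by
  rw [mul_qvi_expression hμ.le, fderiv_const_smul_field]
  simp only [Pi.smul_apply, smul_apply, smul_eq_mul, mul_sub, mul_add, mul_neg,
    mul_inv_cancel_left₀ hμ.ne', mul_left_comm μ lam, mul_assoc]

theorem sub_inv_smul_eq {E : Type*} {μ : ℝ} (hμ : 0 < μ) (v φ : E → ℝ) :
    (fun y => v y - (μ⁻¹ • φ) y) = (μ⁻¹ * ·) ∘ fun y => μ * v y - φ y := by
  ext y
  simp [mul_sub, inv_mul_cancel_left₀ hμ.ne']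

theorem stmt_11
    {n l p q : ℕ} (hn : 0 < n) (hl : 0 < l) (hp : 0 < p) (hq : 0 < q)
    (lam : ℝ) (hlam : 0 < lam)
    (A B : Set (EuclideanSpace ℝ (Fin l)))
    (hA : IsCompact A) (hB : IsCompact B) (hAne : A.Nonempty) (hBne : B.Nonempty)
    (U : Set (EuclideanSpace ℝ (Fin p))) (V : Set (EuclideanSpace ℝ (Fin q)))
    (hUne : U.Nonempty) (hUconv : Convex ℝ U) (hUcone : ∀ r : ℝ, 0 < r → ∀ ξ ∈ U, r • ξ ∈ U)
    (hVne : V.Nonempty) (hVconv : Convex ℝ V) (hVcone : ∀ r : ℝ, 0 < r → ∀ η ∈ V, r • η ∈ V)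
    (b : EuclideanSpace ℝ (Fin n) → A → B → EuclideanSpace ℝ (Fin n))
    (hbBdd : ∃ M : ℝ, ∀ (x : EuclideanSpace ℝ (Fin n)) (a : A) (β : B), ‖b x a β‖ ≤ M)
    (hbCont : Continuous fun z : EuclideanSpace ℝ (Fin n) × A × B => b z.1 z.2.1 z.2.2)
    (f : EuclideanSpace ℝ (Fin n) → A → B → ℝ)
    (hfBdd : ∃ M : ℝ, ∀ (x : EuclideanSpace ℝ (Fin n)) (a : A) (β : B), |f x a β| ≤ M)
    (hfCont : Continuous fun z : EuclideanSpace ℝ (Fin n) × A × B => f z.1 z.2.1 z.2.2)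
    (gξ : EuclideanSpace ℝ (Fin n) → EuclideanSpace ℝ (Fin p) → EuclideanSpace ℝ (Fin n))
    (gη : EuclideanSpace ℝ (Fin n) → EuclideanSpace ℝ (Fin q) → EuclideanSpace ℝ (Fin n))
    (c : EuclideanSpace ℝ (Fin n) → EuclideanSpace ℝ (Fin p) → ℝ)
    (χ : EuclideanSpace ℝ (Fin n) → EuclideanSpace ℝ (Fin q) → ℝ)
    (hcPos : ∀ x : EuclideanSpace ℝ (Fin n), ∀ ξ ∈ U, 0 < c x ξ)
    (hχPos : ∀ x : EuclideanSpace ℝ (Fin n), ∀ η ∈ V, 0 < χ x η)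
    (v : EuclideanSpace ℝ (Fin n) → ℝ) (hv : Continuous v)
    (hsub : (∀ (x₀ : EuclideanSpace ℝ (Fin n)) (φ : EuclideanSpace ℝ (Fin n) → ℝ), ContDiff ℝ 1 φ → IsLocalMax (fun y => v y - φ y) x₀ →
      min (max (lam * v x₀ + (⨅ a : A, ⨆ β : B, (-(fderiv ℝ φ x₀ (b x₀ a β)) - f x₀ a β))) (v x₀ - (⨅ η : V, (v (x₀ + gη x₀ η.1) + χ x₀ η.1)))) (v x₀ - (⨆ ξ : U, (v (x₀ + gξ x₀ ξ.1) - c x₀ ξ.1))) ≤ 0))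
    (hsuper : (∀ (x₀ : EuclideanSpace ℝ (Fin n)) (φ : EuclideanSpace ℝ (Fin n) → ℝ), ContDiff ℝ 1 φ → IsLocalMin (fun y => v y - φ y) x₀ →
      min (max (lam * v x₀ + (⨅ a : A, ⨆ β : B, (-(fderiv ℝ φ x₀ (b x₀ a β)) - f x₀ a β))) (v x₀ - (⨅ η : V, (v (x₀ + gη x₀ η.1) + χ x₀ η.1)))) (v x₀ - (⨆ ξ : U, (v (x₀ + gξ x₀ ξ.1) - c x₀ ξ.1))) ≥ 0))
    (μ : ℝ) (hμ0 : 0 < μ) (hμ1 : μ < 1) :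
    (∀ (x₀ : EuclideanSpace ℝ (Fin n)) (φ : EuclideanSpace ℝ (Fin n) → ℝ), ContDiff ℝ 1 φ → IsLocalMax (fun y => μ * v y - φ y) x₀ →
      min (max (lam * μ * v x₀ + (⨅ a : A, ⨆ β : B, (-(fderiv ℝ φ x₀ (b x₀ a β)) - μ * f x₀ a β))) (μ * v x₀ - (⨅ η : V, (μ * v (x₀ + gη x₀ η.1) + μ * χ x₀ η.1)))) (μ * v x₀ - (⨆ ξ : U, (μ * v (x₀ + gξ x₀ ξ.1) - μ * c x₀ ξ.1))) ≤ 0)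
    ∧
    (∀ (x₀ : EuclideanSpace ℝ (Fin n)) (φ : EuclideanSpace ℝ (Fin n) → ℝ), ContDiff ℝ 1 φ → IsLocalMin (fun y => μ * v y - φ y) x₀ →
      min (max (lam * μ * v x₀ + (⨅ a : A, ⨆ β : B, (-(fderiv ℝ φ x₀ (b x₀ a β)) - μ * f x₀ a β))) (μ * v x₀ - (⨅ η : V, (μ * v (x₀ + gη x₀ η.1) + μ * χ x₀ η.1)))) (μ * v x₀ - (⨆ ξ : U, (μ * v (x₀ + gξ x₀ ξ.1) - μ * c x₀ ξ.1))) ≥ 0) := by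
  have hmono : Monotone (μ⁻¹ * · : ℝ → ℝ) := monotone_mul_left_of_nonneg (inv_nonneg.2 hμ0.le)
  refine ⟨fun x₀ φ hφ hmax => ?_, fun x₀ φ hφ hmin => ?_⟩
  · rw [scaled_qvi_expression hμ0]
    refine mul_nonpos_of_nonneg_of_nonpos hμ0.le (hsub x₀ (μ⁻¹ • φ) (hφ.const_smul μ⁻¹) ?_)
    rw [sub_inv_smul_eq hμ0]
    exact hmax.comp_mono hmono
  · rw [scaled_qvi_expression hμ0]
    refine mul_nonneg hμ0.le (hsuper x₀ (μ⁻¹ • φ) (hφ.const_smul μ⁻¹) ?_)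
    rw [sub_inv_smul_eq hμ0]
    exact hmin.comp_mono hmono
end

section
/- If a continuous function v : ℝ^n → ℝ is a viscosity solution of the upper HJBI QVI (U), then for any 0 < μ < 1 the function μv is a viscosity solution of the scaled QVI max{ min[ λw(x) + H⁺_μ(x, Dw(x)), w(x) − H_sup^{c,μ} w(x) ], w(x) − H_inf^{χ,μ} w(x) } = 0, where H_inf^{χ,μ} w(x) := inf_{η∈V}[w(x+g_η(x,η)) + μχ(x,η)], H_sup^{c,μ} w(x) := sup_{ξ∈U}[w(x+g_ξ(x,ξ)) − μc(x,ξ)], and H⁺_μ(x,p) := sup_{θ₂∈B} inf_{θ₁∈A}(−p·b(x;θ₁,θ₂) − μf(x;θ₁,θ₂)). -/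
open Set MeasureTheory

theorem mul_max_min_of_nonneg {μ : ℝ} (hμ : 0 ≤ μ) (r s t : ℝ) :
    max (min (μ * r) (μ * s)) (μ * t) = μ * max (min r s) t := by
  rw [mul_max_of_nonneg _ _ hμ, mul_min_of_nonneg _ _ hμ]

theorem hjbi_scaling {E ι κ σ τ : Type*} [NormedAddCommGroup E] [NormedSpace ℝ E]
    {μ : ℝ} (hμ : 0 < μ) (lam v₀ : ℝ) (φ : E → ℝ) (x₀ : E)
    (b : ι → κ → E) (f : ι → κ → ℝ) (u c : σ → ℝ) (w χ : τ → ℝ) :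
    max (min (lam * μ * v₀ + (⨆ β, ⨅ a, (-(fderiv ℝ φ x₀ (b a β)) - μ * f a β)))
        (μ * v₀ - (⨆ ξ, (μ * u ξ - μ * c ξ)))) (μ * v₀ - (⨅ η, (μ * w η + μ * χ η))) =
      μ * max (min (lam * v₀ +
          (⨆ β, ⨅ a, (-(fderiv ℝ (fun y => μ⁻¹ * φ y) x₀ (b a β)) - f a β)))
        (v₀ - (⨆ ξ, (u ξ - c ξ)))) (v₀ - (⨅ η, (w η + χ η))) := by
  have hd : fderiv ℝ (fun y => μ⁻¹ * φ y) x₀ = μ⁻¹ • fderiv ℝ φ x₀ :=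
    congrFun (fderiv_const_smul_field (𝕜 := ℝ) (f := φ) μ⁻¹) x₀
  have hH : ∀ a β, -(fderiv ℝ φ x₀ (b a β)) - μ * f a β =
      μ * (-(fderiv ℝ (fun y => μ⁻¹ * φ y) x₀ (b a β)) - f a β) := by
    intro a β
    rw [hd, smul_apply, smul_eq_mul]
    field_simp
  simp only [hH, ← mul_sub, ← mul_add, ← Real.mul_iSup_of_nonneg hμ.le,
    ← Real.mul_iInf_of_nonneg hμ.le]
  rw [mul_comm lam μ, mul_assoc, ← mul_add, mul_max_min_of_nonneg hμ.le]

theorem stmt_12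
    {n l p q : ℕ} (hn : 0 < n) (hl : 0 < l) (hp : 0 < p) (hq : 0 < q)
    (lam : ℝ) (hlam : 0 < lam)
    (A B : Set (EuclideanSpace ℝ (Fin l)))
    (hA : IsCompact A) (hB : IsCompact B) (hAne : A.Nonempty) (hBne : B.Nonempty)
    (U : Set (EuclideanSpace ℝ (Fin p))) (V : Set (EuclideanSpace ℝ (Fin q)))
    (hUne : U.Nonempty) (hUconv : Convex ℝ U) (hUcone : ∀ r : ℝ, 0 < r → ∀ ξ ∈ U, r • ξ ∈ U)
    (hVne : V.Nonempty) (hVconv : Convex ℝ V) (hVcone : ∀ r : ℝ, 0 < r → ∀ η ∈ V, r • η ∈ V)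
    (b : EuclideanSpace ℝ (Fin n) → A → B → EuclideanSpace ℝ (Fin n))
    (hbBdd : ∃ M : ℝ, ∀ (x : EuclideanSpace ℝ (Fin n)) (a : A) (β : B), ‖b x a β‖ ≤ M)
    (hbCont : Continuous fun z : EuclideanSpace ℝ (Fin n) × A × B => b z.1 z.2.1 z.2.2)
    (f : EuclideanSpace ℝ (Fin n) → A → B → ℝ)
    (hfBdd : ∃ M : ℝ, ∀ (x : EuclideanSpace ℝ (Fin n)) (a : A) (β : B), |f x a β| ≤ M)
    (hfCont : Continuous fun z : EuclideanSpace ℝ (Fin n) × A × B => f z.1 z.2.1 z.2.2)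
    (gξ : EuclideanSpace ℝ (Fin n) → EuclideanSpace ℝ (Fin p) → EuclideanSpace ℝ (Fin n))
    (gη : EuclideanSpace ℝ (Fin n) → EuclideanSpace ℝ (Fin q) → EuclideanSpace ℝ (Fin n))
    (c : EuclideanSpace ℝ (Fin n) → EuclideanSpace ℝ (Fin p) → ℝ)
    (χ : EuclideanSpace ℝ (Fin n) → EuclideanSpace ℝ (Fin q) → ℝ)
    (hcPos : ∀ x : EuclideanSpace ℝ (Fin n), ∀ ξ ∈ U, 0 < c x ξ)
    (hχPos : ∀ x : EuclideanSpace ℝ (Fin n), ∀ η ∈ V, 0 < χ x η)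
    (v : EuclideanSpace ℝ (Fin n) → ℝ) (hv : Continuous v)
    (hsub : (∀ (x₀ : EuclideanSpace ℝ (Fin n)) (φ : EuclideanSpace ℝ (Fin n) → ℝ), ContDiff ℝ 1 φ → IsLocalMax (fun y => v y - φ y) x₀ →
      max (min (lam * v x₀ + (⨆ β : B, ⨅ a : A, (-(fderiv ℝ φ x₀ (b x₀ a β)) - f x₀ a β))) (v x₀ - (⨆ ξ : U, (v (x₀ + gξ x₀ ξ.1) - c x₀ ξ.1)))) (v x₀ - (⨅ η : V, (v (x₀ + gη x₀ η.1) + χ x₀ η.1))) ≤ 0))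
    (hsuper : (∀ (x₀ : EuclideanSpace ℝ (Fin n)) (φ : EuclideanSpace ℝ (Fin n) → ℝ), ContDiff ℝ 1 φ → IsLocalMin (fun y => v y - φ y) x₀ →
      max (min (lam * v x₀ + (⨆ β : B, ⨅ a : A, (-(fderiv ℝ φ x₀ (b x₀ a β)) - f x₀ a β))) (v x₀ - (⨆ ξ : U, (v (x₀ + gξ x₀ ξ.1) - c x₀ ξ.1)))) (v x₀ - (⨅ η : V, (v (x₀ + gη x₀ η.1) + χ x₀ η.1))) ≥ 0))
    (μ : ℝ) (hμ0 : 0 < μ) (hμ1 : μ < 1) :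
    (∀ (x₀ : EuclideanSpace ℝ (Fin n)) (φ : EuclideanSpace ℝ (Fin n) → ℝ), ContDiff ℝ 1 φ → IsLocalMax (fun y => μ * v y - φ y) x₀ →
      max (min (lam * μ * v x₀ + (⨆ β : B, ⨅ a : A, (-(fderiv ℝ φ x₀ (b x₀ a β)) - μ * f x₀ a β))) (μ * v x₀ - (⨆ ξ : U, (μ * v (x₀ + gξ x₀ ξ.1) - μ * c x₀ ξ.1)))) (μ * v x₀ - (⨅ η : V, (μ * v (x₀ + gη x₀ η.1) + μ * χ x₀ η.1))) ≤ 0)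
    ∧
    (∀ (x₀ : EuclideanSpace ℝ (Fin n)) (φ : EuclideanSpace ℝ (Fin n) → ℝ), ContDiff ℝ 1 φ → IsLocalMin (fun y => μ * v y - φ y) x₀ →
      max (min (lam * μ * v x₀ + (⨆ β : B, ⨅ a : A, (-(fderiv ℝ φ x₀ (b x₀ a β)) - μ * f x₀ a β))) (μ * v x₀ - (⨆ ξ : U, (μ * v (x₀ + gξ x₀ ξ.1) - μ * c x₀ ξ.1)))) (μ * v x₀ - (⨅ η : V, (μ * v (x₀ + gη x₀ η.1) + μ * χ x₀ η.1))) ≥ 0) := by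
  have hrescale : ∀ φ : EuclideanSpace ℝ (Fin n) → ℝ, (fun y => v y - μ⁻¹ * φ y) =
      (fun t => μ⁻¹ * t) ∘ (fun y => μ * v y - φ y) := by
    intro φ
    funext y
    simp only [Function.comp_apply]
    field_simp
  have hmono : Monotone fun t : ℝ => μ⁻¹ * t :=
    monotone_mul_left_of_nonneg (inv_pos.mpr hμ0).le
  constructor
  · intro x₀ φ hφ hmax
    have h := hsub x₀ (fun y => μ⁻¹ * φ y) (contDiff_const.mul hφ)
      (by rw [hrescale]; exact hmax.comp_mono hmono)
    rw [hjbi_scaling hμ0]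
    exact mul_nonpos_of_nonneg_of_nonpos hμ0.le h
  · intro x₀ φ hφ hmin
    have h := hsuper x₀ (fun y => μ⁻¹ * φ y) (contDiff_const.mul hφ)
      (by rw [hrescale]; exact hmin.comp_mono hmono)
    rw [hjbi_scaling hμ0]
    exact mul_nonneg hμ0.le h
end

section
/- Let u, v : ℝ^n → ℝ be bounded functions, μ ∈ (0,1), and suppose χ : ℝ^n×V → ℝ satisfies χ(x,η) ≥ χ₀ for all x, η, where χ₀ > 0. Then for every x ∈ ℝ^n: H_inf^{χ,μ}(μu)(x) − H_inf^χ v(x) ≤ sup_{y∈ℝ^n} (μu(y) − v(y))⁺ − (1−μ)·χ₀, where H_inf^{χ,μ} w(x) := inf_{η∈V}[w(x+g_η(x,η)) + μχ(x,η)] and H_inf^χ w(x) := inf_{η∈V}[w(x+g_η(x,η)) + χ(x,η)]. Consequently sup_x ( H_inf^{χ,μ}(μu)(x) − H_inf^χ v(x) )⁺ < sup_x (μu(x) − v(x))⁺ whenever sup_x (μu(x) − v(x))⁺ > 0. -/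
open Set

/-- The intervention operator with discounted cost `μ * c`, applied to `a`, exceeds the one with
cost `c`, applied to `b`, by at most `S - (1 - μ) * c₀` when `a ≤ b + S` and `c₀ ≤ c`. -/
theorem iInf_add_mul_sub_iInf_add_le {ι : Type*} [Nonempty ι] {a b c : ι → ℝ} {μ c₀ S : ℝ}
    (ha : BddBelow (range a)) (hc : ∀ i, c₀ ≤ c i) (hμ0 : 0 ≤ μ) (hμ1 : μ ≤ 1)
    (hab : ∀ i, a i - b i ≤ S) :
    (⨅ i, (a i + μ * c i)) - (⨅ i, (b i + c i)) ≤ S - (1 - μ) * c₀ := by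
  have hbdd : BddBelow (range fun i => a i + μ * c i) := by
    obtain ⟨m, hm⟩ := ha
    refine ⟨m + μ * c₀, ?_⟩
    rintro _ ⟨i, rfl⟩
    exact add_le_add (hm ⟨i, rfl⟩) (mul_le_mul_of_nonneg_left (hc i) hμ0)
  have key : (⨅ i, (a i + μ * c i)) - (S - (1 - μ) * c₀) ≤ ⨅ i, (b i + c i) := by
    refine le_ciInf fun i => ?_
    have h1 := ciInf_le hbdd i
    have h2 := mul_le_mul_of_nonneg_left (hc i) (sub_nonneg.2 hμ1)
    linarith [hab i]
  linarith

theorem stmt_18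
    {n q : ℕ} (hn : 0 < n) (hq : 0 < q)
    (V : Set (EuclideanSpace ℝ (Fin q)))
    (hVne : V.Nonempty) (hVconv : Convex ℝ V) (hVcone : ∀ r : ℝ, 0 < r → ∀ η ∈ V, r • η ∈ V)
    (gη : EuclideanSpace ℝ (Fin n) → EuclideanSpace ℝ (Fin q) → EuclideanSpace ℝ (Fin n))
    (χ : EuclideanSpace ℝ (Fin n) → EuclideanSpace ℝ (Fin q) → ℝ)
    (χ₀ : ℝ) (hχ₀ : 0 < χ₀)
    (hχ : ∀ x : EuclideanSpace ℝ (Fin n), ∀ η ∈ V, χ₀ ≤ χ x η)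
    (u v : EuclideanSpace ℝ (Fin n) → ℝ)
    (hub : ∃ M : ℝ, ∀ x, |u x| ≤ M) (hvb : ∃ M : ℝ, ∀ x, |v x| ≤ M)
    (μ : ℝ) (hμ0 : 0 < μ) (hμ1 : μ < 1) :
    (∀ x : EuclideanSpace ℝ (Fin n),
      (⨅ η : V, (μ * u (x + gη x η.1) + μ * χ x η.1)) -
        (⨅ η : V, (v (x + gη x η.1) + χ x η.1)) ≤
      (⨆ y : EuclideanSpace ℝ (Fin n), max (μ * u y - v y) 0) - (1 - μ) * χ₀) ∧
    (0 < (⨆ x : EuclideanSpace ℝ (Fin n), max (μ * u x - v x) 0) →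
      (⨆ x : EuclideanSpace ℝ (Fin n),
        max ((⨅ η : V, (μ * u (x + gη x η.1) + μ * χ x η.1)) -
          (⨅ η : V, (v (x + gη x η.1) + χ x η.1))) 0) <
      ⨆ x : EuclideanSpace ℝ (Fin n), max (μ * u x - v x) 0) := by
  have : Nonempty V := hVne.to_subtype
  obtain ⟨M, hM⟩ := hub
  obtain ⟨N, hN⟩ := hvb
  have hμu : ∀ y, |μ * u y| ≤ μ * M := fun y => by
    rw [abs_mul, abs_of_pos hμ0]
    exact mul_le_mul_of_nonneg_left (hM y) hμ0.le
  have hbdd : BddAbove (range fun y => max (μ * u y - v y) 0) := by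
    refine ⟨max (μ * M + N) 0, ?_⟩
    rintro _ ⟨y, rfl⟩
    refine max_le_max_right 0 ?_
    linarith [(abs_le.1 (hμu y)).2, (abs_le.1 (hN y)).1]
  have gap := fun x => iInf_add_mul_sub_iInf_add_le
    (a := fun η : V => μ * u (x + gη x η.1)) (b := fun η : V => v (x + gη x η.1))
    (c := fun η : V => χ x η.1)
    ⟨-(μ * M), by rintro _ ⟨η, rfl⟩; exact (abs_le.1 (hμu _)).1⟩
    (fun η => hχ x η.1 η.2) hμ0.le hμ1.le
    (fun η => (le_max_left _ _).trans (le_ciSup hbdd (x + gη x η.1)))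
  refine ⟨gap, fun hS => ?_⟩
  have hpos : 0 < (1 - μ) * χ₀ := mul_pos (sub_pos.2 hμ1) hχ₀
  exact (ciSup_le fun x => max_le_max_right 0 (gap x)).trans_lt
    (max_lt (sub_lt_self _ hpos) hS)
end
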